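/- Let θ be a real number, let G be θ-super positive, and let e₁=(u,v) be an edge of G such that {u,v} is a θ-extreme set in G. Let G' = G−e₁ and let e₂=(w,z) be an edge of G'. Then {w,z} is a θ-extreme set in G' if and only if {w,z} is a θ-extreme set in G. -/

import Mathlib

open Polynomial

namespace MatchPoly

variable {V : Type*}

/-- The number of `r`-matchings in `G`: sets of `r` edges, no two sharing a vertex. -/
noncomputable def numMatchings (G : SimpleGraph V) (r : ℕ) : ℕ :=
  Nat.card {M : Finset (Sym2 V) // M.card = r ∧ (M : Set (Sym2 V)) ⊆ G.edgeSet ∧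
    (M : Set (Sym2 V)).Pairwise fun e f => ∀ v : V, v ∈ e → v ∉ f}

/-- The matching polynomial `μ(G,x) = ∑ (-1)^r p(G,r) x^(n-2r)`. -/
noncomputable def matchingPoly (G : SimpleGraph V) : Polynomial ℝ :=
  ∑ r ∈ Finset.range (Nat.card V + 1),
    Polynomial.C ((-1 : ℝ) ^ r * (numMatchings G r : ℝ)) *
      (Polynomial.X : Polynomial ℝ) ^ (Nat.card V - 2 * r)

/-- `mult θ G`: the multiplicity of `θ` as a root of `μ(G,x)`. -/
noncomputable def mult (θ : ℝ) (G : SimpleGraph V) : ℕ :=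
  (matchingPoly G).rootMultiplicity θ

/-- `G \ X`: the induced subgraph on the complement of the vertex set `X`. -/
def deleteSet (G : SimpleGraph V) (X : Set V) : SimpleGraph ↥(Xᶜ) :=
  G.induce (Xᶜ)

/-- `G \ v`: delete a single vertex. -/
def deleteVert (G : SimpleGraph V) (v : V) : SimpleGraph ↥({v}ᶜ : Set V) :=
  G.induce ({v}ᶜ : Set V)

/-- `u` is θ-essential: `mult(θ, G\u) = mult(θ,G) - 1`. -/
def IsEssential (θ : ℝ) (G : SimpleGraph V) (u : V) : Prop :=
  mult θ (deleteVert G u) + 1 = mult θ G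

/-- `u` is θ-neutral: `mult(θ, G\u) = mult(θ,G)`. -/
def IsNeutral (θ : ℝ) (G : SimpleGraph V) (u : V) : Prop :=
  mult θ (deleteVert G u) = mult θ G

/-- `u` is θ-positive: `mult(θ, G\u) = mult(θ,G) + 1`. -/
def IsPositive (θ : ℝ) (G : SimpleGraph V) (u : V) : Prop :=
  mult θ (deleteVert G u) = mult θ G + 1

/-- `u` is θ-special: not θ-essential but adjacent to a θ-essential vertex. -/
def IsSpecial (θ : ℝ) (G : SimpleGraph V) (u : V) : Prop :=
  ¬ IsEssential θ G u ∧ ∃ w : V, G.Adj u w ∧ IsEssential θ G w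

/-- `A_θ(G)`: the set of θ-special vertices. -/
def specialSet (θ : ℝ) (G : SimpleGraph V) : Set V := {u | IsSpecial θ G u}

/-- `N_θ(G)`: the set of θ-neutral vertices. -/
def neutralSet (θ : ℝ) (G : SimpleGraph V) : Set V := {u | IsNeutral θ G u}

/-- `P_θ(G)`: the set of θ-positive vertices that are not θ-special. -/
def positiveSet (θ : ℝ) (G : SimpleGraph V) : Set V :=
  {u | IsPositive θ G u ∧ ¬ IsSpecial θ G u}

/-- `G` is θ-super positive: `mult(θ,G) = 0` and `mult(θ,G\v) = 1` for every vertex `v`. -/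
def IsSuperPositive (θ : ℝ) (G : SimpleGraph V) : Prop :=
  mult θ G = 0 ∧ ∀ v : V, mult θ (deleteVert G v) = 1

/-- `G` is θ-elementary: θ-super positive and `P_θ(G\v) = ∅` for every vertex `v`. -/
def IsElementary (θ : ℝ) (G : SimpleGraph V) : Prop :=
  IsSuperPositive θ G ∧ ∀ v : V, positiveSet θ (deleteVert G v) = ∅

/-- `G` is θ-critical: every vertex is θ-essential and `mult(θ,G) = 1`. -/
def IsCritical (θ : ℝ) (G : SimpleGraph V) : Prop :=
  (∀ v : V, IsEssential θ G v) ∧ mult θ G = 1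

/-- `c_θ(G)`: the number of θ-critical connected components of `G`. -/
noncomputable def numCritComponents (θ : ℝ) (G : SimpleGraph V) : ℕ :=
  Nat.card {c : G.ConnectedComponent // IsCritical θ (G.induce c.supp)}

/-- `X` is a θ-barrier set: `mult(θ,G) = c_θ(G\X) - |X|`. -/
def IsBarrier (θ : ℝ) (G : SimpleGraph V) (X : Set V) : Prop :=
  numCritComponents θ (deleteSet G X) = mult θ G + X.ncard

/-- `X` is a θ-extreme set: `mult(θ,G\X) = mult(θ,G) + |X|`. -/
def IsExtreme (θ : ℝ) (G : SimpleGraph V) (X : Set V) : Prop :=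
  mult θ (deleteSet G X) = mult θ G + X.ncard

/-- `G` is θ-base: θ-super positive and no θ-barrier set contains two adjacent vertices. -/
def IsBase (θ : ℝ) (G : SimpleGraph V) : Prop :=
  IsSuperPositive θ G ∧
    ∀ X : Set V, IsBarrier θ G X → ∀ u v : V, u ∈ X → v ∈ X → ¬ G.Adj u v

/-- `M` is a matching of `G` covering only vertices of `S`. -/
def IsMatchingOn (G : SimpleGraph V) (S : Finset V) (M : Finset (Sym2 V)) : Prop :=
  (∀ e ∈ M, e ∈ G.edgeSet) ∧ (∀ e ∈ M, ∀ a ∈ e, a ∈ S) ∧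
    ∀ e ∈ M, ∀ f ∈ M, e ≠ f → ∀ a : V, a ∈ e → a ∉ f

open Classical in
/-- The matchings of `G` with `r` edges that cover only vertices of `S`. -/
noncomputable def matchingsOn [Fintype V] (G : SimpleGraph V) (S : Finset V) (r : ℕ) :
    Finset (Finset (Sym2 V)) :=
  {M | M.card = r ∧ IsMatchingOn G S M}

/-- The matching polynomial of the subgraph of `G` induced on `S`. -/
noncomputable def matchingPolyOn [Fintype V] (G : SimpleGraph V) (S : Finset V) : ℝ[X] :=
  ∑ r ∈ Finset.range (Fintype.card V + 1),
    C ((-1 : ℝ) ^ r * ((matchingsOn G S r).card : ℝ)) * X ^ (S.card - 2 * r)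

lemma mem_matchingsOn [Fintype V] {G : SimpleGraph V} {S : Finset V} {r : ℕ}
    {M : Finset (Sym2 V)} :
    M ∈ matchingsOn G S r ↔ M.card = r ∧ IsMatchingOn G S M := by
  simp [matchingsOn]

lemma card_matchingsOn_zero [Fintype V] (G : SimpleGraph V) (S : Finset V) :
    (matchingsOn G S 0).card = 1 := by
  rw [Finset.card_eq_one]
  refine ⟨∅, ?_⟩
  ext M
  rw [mem_matchingsOn, Finset.mem_singleton, Finset.card_eq_zero]
  constructor
  · exact fun h => h.1
  · rintro rfl
    simp [IsMatchingOn]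

lemma matchingsOn_empty [Fintype V] (G : SimpleGraph V) (r : ℕ) :
    matchingsOn G ∅ (r + 1) = ∅ := by
  ext M
  rw [mem_matchingsOn]
  simp only [Finset.notMem_empty, iff_false, not_and]
  intro hM h
  obtain ⟨e, he⟩ := Finset.card_pos.1 (by omega : 0 < M.card)
  induction e with
  | h a b => simpa using h.2.1 _ he a (by simp)

/-- Matchings on `S` using the edge `wy` correspond to matchings on `S \ {w, y}`. -/
lemma card_matchingsOn_filter_edge [Fintype V] [DecidableEq V] {G : SimpleGraph V} {S : Finset V} {w y : V}
    (hw : w ∈ S) (hy : y ∈ S) (hwy : G.Adj w y) (r : ℕ) :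
    ((matchingsOn G S (r + 1)).filter (fun M => s(w, y) ∈ M)).card =
      (matchingsOn G ((S.erase w).erase y) r).card := by
  refine Finset.card_bij' (fun M _ => M.erase s(w, y)) (fun M _ => insert s(w, y) M) ?_ ?_ ?_ ?_
  · intro M hM
    rw [Finset.mem_filter, mem_matchingsOn] at hM
    obtain ⟨⟨hc, h1, h2, h3⟩, hm⟩ := hM
    rw [mem_matchingsOn]
    refine ⟨by rw [Finset.card_erase_of_mem hm, hc]; rfl, ?_, ?_, ?_⟩
    · exact fun e he => h1 e (Finset.mem_of_mem_erase he)
    · intro e he a ha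
      obtain ⟨hne, he⟩ := Finset.mem_erase.1 he
      have := h3 e he _ hm hne a ha
      simp only [Sym2.mem_iff, not_or] at this
      simp [this.1, this.2, h2 e he a ha]
    · exact fun e he f hf => h3 e (Finset.mem_of_mem_erase he) f (Finset.mem_of_mem_erase hf)
  · intro M hM
    rw [mem_matchingsOn] at hM
    obtain ⟨hc, h1, h2, h3⟩ := hM
    have havoid : ∀ e ∈ M, ∀ a ∈ e, a ∉ s(w, y) := by
      intro e he a ha
      have := h2 e he a ha
      simp only [Finset.mem_erase] at this
      simp [this.1, this.2.1]
    have hm : s(w, y) ∉ M := fun hm => havoid _ hm w (by simp) (by simp)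
    rw [Finset.mem_filter, mem_matchingsOn]
    refine ⟨⟨by rw [Finset.card_insert_of_notMem hm, hc], ?_, ?_, ?_⟩, by simp⟩
    · intro e he
      rcases Finset.mem_insert.1 he with rfl | he
      · exact hwy
      · exact h1 e he
    · intro e he a ha
      rcases Finset.mem_insert.1 he with rfl | he
      · rcases Sym2.mem_iff.1 ha with rfl | rfl <;> assumption
      · exact Finset.mem_of_mem_erase (Finset.mem_of_mem_erase (h2 e he a ha))
    · intro e he f hf hef a hae haf
      rcases Finset.mem_insert.1 he with rfl | he <;> rcases Finset.mem_insert.1 hf with rfl | hf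
      · exact hef rfl
      · exact havoid f hf a haf hae
      · exact havoid e he a hae haf
      · exact h3 e he f hf hef a hae haf
  · intro M hM
    exact Finset.insert_erase (Finset.mem_filter.1 hM).2
  · intro M hM
    refine Finset.erase_insert fun hm => ?_
    have := (mem_matchingsOn.1 hM).2.2.1 _ hm w (by simp)
    simp at this

lemma card_matchingsOn_succ [Fintype V] [DecidableEq V] {G : SimpleGraph V}
    [DecidableRel G.Adj] {S : Finset V} {w : V} (hw : w ∈ S) (r : ℕ) :
    (matchingsOn G S (r + 1)).card = (matchingsOn G (S.erase w) (r + 1)).card +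
      ∑ y ∈ (S.erase w).filter (G.Adj w), (matchingsOn G ((S.erase w).erase y) r).card := by
  have hsplit : matchingsOn G S (r + 1) = matchingsOn G (S.erase w) (r + 1) ∪
      ((S.erase w).filter (G.Adj w)).biUnion
        (fun y => (matchingsOn G S (r + 1)).filter (fun M => s(w, y) ∈ M)) := by
    ext M
    simp only [Finset.mem_union, Finset.mem_biUnion, Finset.mem_filter, mem_matchingsOn]
    constructor
    · rintro ⟨hc, h1, h2, h3⟩
      by_cases hcov : ∃ e ∈ M, w ∈ e
      · obtain ⟨e, he, hwe⟩ := hcov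
        obtain ⟨y, rfl⟩ := hwe
        have hadj : G.Adj w y := h1 _ he
        exact Or.inr ⟨y, ⟨Finset.mem_erase.2 ⟨hadj.ne', h2 _ he y (by simp)⟩, hadj⟩,
          ⟨hc, h1, h2, h3⟩, he⟩
      · push Not at hcov
        refine Or.inl ⟨hc, h1, fun e he a ha => Finset.mem_erase.2 ⟨?_, h2 e he a ha⟩, h3⟩
        rintro rfl
        exact hcov e he ha
    · rintro (⟨hc, h1, h2, h3⟩ | ⟨y, -, h, -⟩)
      · exact ⟨hc, h1, fun e he a ha => Finset.mem_of_mem_erase (h2 e he a ha), h3⟩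
      · exact h
  rw [hsplit, Finset.card_union_of_disjoint, Finset.card_biUnion]
  · congr 1
    refine Finset.sum_congr rfl fun y hy => ?_
    simp only [Finset.mem_filter, Finset.mem_erase] at hy
    exact card_matchingsOn_filter_edge hw hy.1.2 hy.2 r
  · intro y _ y' _ hyy'
    rw [Function.onFun, Finset.disjoint_left]
    intro M hM hM'
    rw [Finset.mem_filter, mem_matchingsOn] at hM hM'
    refine hM.1.2.2.2 _ hM.2 _ hM'.2 ?_ w (by simp) (by simp)
    exact fun heq => hyy' (Sym2.congr_right.1 heq)
  · rw [Finset.disjoint_left]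
    intro M hM hM'
    simp only [Finset.mem_biUnion, Finset.mem_filter] at hM'
    obtain ⟨y, -, -, hy⟩ := hM'
    have := (mem_matchingsOn.1 hM).2.2.1 _ hy w (by simp)
    simp at this

lemma card_matchingsOn_eq_zero [Fintype V] (G : SimpleGraph V) (S : Finset V) (r : ℕ)
    (hr : S.card < 2 * r) : (matchingsOn G S r).card = 0 := by
  classical
  induction S using Finset.strongInduction generalizing r with
  | H S ih =>
    obtain _ | r := r
    · omega
    rcases S.eq_empty_or_nonempty with rfl | ⟨w, hw⟩
    · rw [matchingsOn_empty, Finset.card_empty]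
    · have hc := Finset.card_erase_of_mem hw
      rw [card_matchingsOn_succ hw, ih _ (Finset.erase_ssubset hw) _ (by omega), zero_add]
      refine Finset.sum_eq_zero fun y hy => ?_
      have hy' := (Finset.mem_filter.1 hy).1
      have hc' := Finset.card_erase_of_mem hy'
      have := Finset.card_pos.2 ⟨y, hy'⟩
      exact ih _ ((Finset.erase_subset _ _).trans_ssubset (Finset.erase_ssubset hw)) _ (by omega)

lemma matchingPolyOn_empty [Fintype V] (G : SimpleGraph V) : matchingPolyOn G ∅ = 1 := by
  rw [matchingPolyOn, Finset.sum_range_succ']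
  simp [matchingsOn_empty, card_matchingsOn_zero]

/-- The vertex recurrence for the matching polynomial. -/
lemma matchingPolyOn_eq_sub [Fintype V] [DecidableEq V] {G : SimpleGraph V}
    [DecidableRel G.Adj] {S : Finset V} {w : V} (hw : w ∈ S) :
    matchingPolyOn G S = X * matchingPolyOn G (S.erase w) -
      ∑ y ∈ (S.erase w).filter (G.Adj w), matchingPolyOn G ((S.erase w).erase y) := by
  have hcw := Finset.card_erase_of_mem hw
  have hpos := Finset.card_pos.2 ⟨w, hw⟩
  have hX : X * matchingPolyOn G (S.erase w) = ∑ r ∈ Finset.range (Fintype.card V + 1),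
      C ((-1 : ℝ) ^ r * ((matchingsOn G (S.erase w) r).card : ℝ)) * X ^ (S.card - 2 * r) := by
    rw [matchingPolyOn, Finset.mul_sum]
    refine Finset.sum_congr rfl fun r _ => ?_
    by_cases hr : (S.erase w).card < 2 * r
    · simp [card_matchingsOn_eq_zero _ _ _ hr]
    · rw [show S.card - 2 * r = (S.erase w).card - 2 * r + 1 by omega]
      ring
  have hY : ∀ y ∈ (S.erase w).filter (G.Adj w), matchingPolyOn G ((S.erase w).erase y) =
      ∑ r ∈ Finset.range (Fintype.card V),
        C ((-1 : ℝ) ^ r * ((matchingsOn G ((S.erase w).erase y) r).card : ℝ)) *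
          X ^ (S.card - 2 * (r + 1)) := by
    intro y hy
    have hy' := (Finset.mem_filter.1 hy).1
    have hc' := Finset.card_erase_of_mem hy'
    have hpos' := Finset.card_pos.2 ⟨y, hy'⟩
    have hle := Finset.card_le_univ S
    rw [matchingPolyOn, Finset.sum_range_succ,
      card_matchingsOn_eq_zero _ _ (Fintype.card V) (by omega)]
    simp only [Nat.cast_zero, mul_zero, C_0, zero_mul, add_zero]
    refine Finset.sum_congr rfl fun r _ => ?_
    congr 2
    omega
  rw [hX, Finset.sum_congr rfl hY, Finset.sum_comm, matchingPolyOn, Finset.sum_range_succ',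
    Finset.sum_range_succ', card_matchingsOn_zero, card_matchingsOn_zero, add_sub_right_comm,
    ← Finset.sum_sub_distrib]
  congr 1
  refine Finset.sum_congr rfl fun r _ => ?_
  rw [card_matchingsOn_succ hw, ← Finset.sum_mul, ← sub_mul]
  congr 1
  rw [← map_sum, ← C_sub, ← Finset.mul_sum]
  congr 1
  push_cast
  ring

lemma isMatchingOn_univ_iff [Fintype V] {G : SimpleGraph V} {M : Finset (Sym2 V)} :
    IsMatchingOn G Finset.univ M ↔ (M : Set (Sym2 V)) ⊆ G.edgeSet ∧
      (M : Set (Sym2 V)).Pairwise fun e f => ∀ v : V, v ∈ e → v ∉ f := by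
  simp only [IsMatchingOn, Finset.mem_univ, implies_true, true_and]
  exact ⟨fun h => ⟨fun e he => h.1 e he, fun e he f hf => h.2 e he f hf⟩,
    fun h => ⟨fun e he => h.1 he, fun e he f hf => h.2 he hf⟩⟩

lemma numMatchings_eq_card_matchingsOn [Fintype V] (G : SimpleGraph V) (r : ℕ) :
    numMatchings G r = (matchingsOn G Finset.univ r).card :=
  Nat.subtype_card _ fun M => by rw [mem_matchingsOn, isMatchingOn_univ_iff]

lemma matchingPoly_eq_matchingPolyOn [Fintype V] (G : SimpleGraph V) :
    matchingPoly G = matchingPolyOn G Finset.univ := by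
  simp only [matchingPoly, matchingPolyOn, numMatchings_eq_card_matchingsOn,
    Nat.card_eq_fintype_card, Finset.card_univ]

lemma isMatchingOn_induce_iff {G : SimpleGraph V} {T : Set V} [Fintype T] {S : Finset V}
    (hS : ∀ x, x ∈ S ↔ x ∈ T) {M : Finset (Sym2 T)} :
    IsMatchingOn (G.induce T) Finset.univ M ↔ IsMatchingOn G S
      (M.map ⟨Sym2.map Subtype.val, Sym2.map.injective Subtype.val_injective⟩) := by
  have hedge : ∀ e : Sym2 T, e ∈ (G.induce T).edgeSet ↔ e.map Subtype.val ∈ G.edgeSet := by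
    intro e
    induction e with
    | h a b => simp
  simp only [IsMatchingOn, Finset.forall_mem_map, Function.Embedding.coeFn_mk, hedge,
    Finset.mem_univ, implies_true, true_and, Sym2.mem_map]
  refine and_congr_right fun _ => ?_
  constructor
  · intro h
    refine ⟨?_, ?_⟩
    · rintro e - _ ⟨a, -, rfl⟩
      exact (hS _).2 a.2
    · rintro e he f hf hef _ ⟨a, ha, rfl⟩ ⟨b, hb, hab⟩
      rw [Subtype.val_injective hab] at hb
      exact h e he f hf (fun h => hef (h ▸ rfl)) a ha hb
  · rintro ⟨-, h⟩ e he f hf hef a ha hb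
    exact h e he f hf (fun h => hef (Sym2.map.injective Subtype.val_injective h)) a
      ⟨a, ha, rfl⟩ ⟨a, hb, rfl⟩

lemma numMatchings_induce [Fintype V] (G : SimpleGraph V) {T : Set V} {S : Finset V}
    (hS : ∀ x, x ∈ S ↔ x ∈ T) (r : ℕ) :
    numMatchings (G.induce T) r = (matchingsOn G S r).card := by
  classical
  rw [numMatchings_eq_card_matchingsOn]
  refine Finset.card_bij (fun M _ =>
    M.map ⟨Sym2.map Subtype.val, Sym2.map.injective Subtype.val_injective⟩) ?_ ?_ ?_
  · intro M hM
    rw [mem_matchingsOn, isMatchingOn_induce_iff hS] at hM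
    rwa [mem_matchingsOn, Finset.card_map]
  · intro M _ M' _ h
    exact Finset.map_injective _ h
  · intro M hM
    rw [mem_matchingsOn] at hM
    have hpre : ∃ N : Finset (Sym2 T),
        N.map ⟨Sym2.map Subtype.val, Sym2.map.injective Subtype.val_injective⟩ = M := by
      refine ⟨Finset.univ.filter (fun e => e.map Subtype.val ∈ M), ?_⟩
      ext e
      simp only [Finset.mem_map, Finset.mem_filter, Finset.mem_univ, true_and,
        Function.Embedding.coeFn_mk]
      constructor
      · rintro ⟨e, he, rfl⟩
        exact he
      · intro he
        have hmem := hM.2.2.1 e he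
        induction e with
        | h a b =>
          exact ⟨s(⟨a, (hS a).1 (hmem a (by simp))⟩, ⟨b, (hS b).1 (hmem b (by simp))⟩), he, rfl⟩
    obtain ⟨N, rfl⟩ := hpre
    refine ⟨N, ?_, rfl⟩
    rwa [mem_matchingsOn, isMatchingOn_induce_iff hS, ← Finset.card_map]

lemma matchingPoly_induce [Fintype V] (G : SimpleGraph V) {T : Set V} {S : Finset V}
    (hS : ∀ x, x ∈ S ↔ x ∈ T) : matchingPoly (G.induce T) = matchingPolyOn G S := by
  have hcard : Nat.card T = S.card := Nat.subtype_card S hS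
  simp only [matchingPoly, matchingPolyOn, numMatchings_induce G hS, hcard]
  refine Finset.sum_subset (Finset.range_mono (by have := Finset.card_le_univ S; omega)) ?_
  intro r _ hr
  rw [Finset.mem_range] at hr
  simp [card_matchingsOn_eq_zero G S r (by omega)]

lemma matchingPolyOn_congr [Fintype V] {G G' : SimpleGraph V} {S : Finset V}
    (h : ∀ a ∈ S, ∀ b ∈ S, G.Adj a b ↔ G'.Adj a b) :
    matchingPolyOn G S = matchingPolyOn G' S := by
  have hiff : ∀ M, IsMatchingOn G S M ↔ IsMatchingOn G' S M := by
    intro M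
    have key : ∀ e : Sym2 V, (∀ a ∈ e, a ∈ S) → (e ∈ G.edgeSet ↔ e ∈ G'.edgeSet) := by
      intro e he
      induction e with
      | h a b => exact h a (he a (by simp)) b (he b (by simp))
    exact ⟨fun hM => ⟨fun e he => (key e (hM.2.1 e he)).1 (hM.1 e he), hM.2⟩,
      fun hM => ⟨fun e he => (key e (hM.2.1 e he)).2 (hM.1 e he), hM.2⟩⟩
  have hset : ∀ r, matchingsOn G S r = matchingsOn G' S r := fun r => by
    ext M
    rw [mem_matchingsOn, mem_matchingsOn, hiff]
  simp only [matchingPolyOn, hset]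

lemma matchingPolyOn_deleteEdges_of_notMem [Fintype V] {G : SimpleGraph V} {S : Finset V}
    {u v : V} (h : u ∉ S ∨ v ∉ S) :
    matchingPolyOn (G.deleteEdges {s(u, v)}) S = matchingPolyOn G S := by
  refine matchingPolyOn_congr fun a ha b hb => ?_
  simp only [SimpleGraph.deleteEdges_adj, Set.mem_singleton_iff, and_iff_left_iff_imp]
  rintro - heq
  rcases Sym2.eq_iff.1 heq with ⟨rfl, rfl⟩ | ⟨rfl, rfl⟩ <;> tauto

/-- The edge recurrence for the matching polynomial. -/
lemma matchingPolyOn_deleteEdges [Fintype V] [DecidableEq V] {G : SimpleGraph V} {S : Finset V}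
    {u v : V} (hu : u ∈ S) (hv : v ∈ S) (huv : G.Adj u v) :
    matchingPolyOn (G.deleteEdges {s(u, v)}) S =
      matchingPolyOn G S + matchingPolyOn G ((S.erase u).erase v) := by
  classical
  have hnbr : (S.erase u).filter (G.Adj u) =
      insert v ((S.erase u).filter ((G.deleteEdges {s(u, v)}).Adj u)) := by
    ext y
    by_cases hy : y = v
    · subst hy
      simp [hv, huv, huv.ne']
    · simp [hy, huv.ne]
  have herase : ∀ T : Finset V, T ⊆ S.erase u →
      matchingPolyOn (G.deleteEdges {s(u, v)}) T = matchingPolyOn G T := fun T hT =>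
    matchingPolyOn_deleteEdges_of_notMem (Or.inl fun h => by simpa using hT h)
  have hG := matchingPolyOn_eq_sub (G := G) hu
  have hG' := matchingPolyOn_eq_sub (G := G.deleteEdges {s(u, v)}) hu
  rw [hnbr, Finset.sum_insert (by simp)] at hG
  rw [herase _ subset_rfl, Finset.sum_congr rfl fun y _ => herase _ (Finset.erase_subset y _)]
    at hG'
  rw [hG, hG']
  ring

lemma sq_eval_le_eval_wronskian [Fintype V] [DecidableEq V] (G : SimpleGraph V) (S : Finset V)
    (w : V) (hw : w ∈ S) (x : ℝ) :
    ((matchingPolyOn G (S.erase w)).eval x) ^ 2 ≤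
      (derivative (matchingPolyOn G S) * matchingPolyOn G (S.erase w) -
        matchingPolyOn G S * derivative (matchingPolyOn G (S.erase w))).eval x := by
  classical
  induction S using Finset.strongInduction generalizing w with
  | H S ih =>
    have hrec := matchingPolyOn_eq_sub (G := G) hw
    have hsum : derivative (matchingPolyOn G S) * matchingPolyOn G (S.erase w) -
        matchingPolyOn G S * derivative (matchingPolyOn G (S.erase w)) =
        matchingPolyOn G (S.erase w) ^ 2 + ∑ y ∈ (S.erase w).filter (G.Adj w),
          (derivative (matchingPolyOn G (S.erase w)) * matchingPolyOn G ((S.erase w).erase y) -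
            matchingPolyOn G (S.erase w) *
              derivative (matchingPolyOn G ((S.erase w).erase y))) := by
      rw [Finset.sum_sub_distrib, ← Finset.mul_sum, ← Finset.mul_sum, ← derivative_sum,
        hrec]
      generalize ∑ y ∈ (S.erase w).filter (G.Adj w), matchingPolyOn G ((S.erase w).erase y) = B
      simp only [derivative_sub, derivative_mul, derivative_X]
      ring
    rw [hsum, eval_add, eval_pow, eval_finsetSum, le_add_iff_nonneg_right]
    refine Finset.sum_nonneg fun y hy => ?_
    exact (sq_nonneg _).trans (ih _ (Finset.erase_ssubset hw) y (Finset.mem_filter.1 hy).1)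

/-- The difference `μ(G\w) μ(G\z) - μ(G) μ(G\{w,z})` is nonnegative, and at least
`μ(G\{w,z})²` if `w` and `z` are adjacent. -/
lemma eval_erase_erase_sq_le [Fintype V] [DecidableEq V] (G : SimpleGraph V) (S : Finset V)
    {w z : V} (hw : w ∈ S) (hz : z ∈ S) (hwz : w ≠ z) (x : ℝ) :
    0 ≤ (matchingPolyOn G (S.erase w) * matchingPolyOn G (S.erase z) -
        matchingPolyOn G S * matchingPolyOn G ((S.erase w).erase z)).eval x ∧
      (G.Adj w z → ((matchingPolyOn G ((S.erase w).erase z)).eval x) ^ 2 ≤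
      (matchingPolyOn G (S.erase w) * matchingPolyOn G (S.erase z) -
        matchingPolyOn G S * matchingPolyOn G ((S.erase w).erase z)).eval x) := by
  classical
  induction S using Finset.strongInduction generalizing w z with
  | H S ih =>
    have hzw : z ∈ S.erase w := Finset.mem_erase.2 ⟨hwz.symm, hz⟩
    have hS := matchingPolyOn_eq_sub (G := G) hw
    have hSz := matchingPolyOn_eq_sub (G := G) (Finset.mem_erase.2 ⟨hwz, hw⟩ : w ∈ S.erase z)
    rw [Finset.erase_right_comm (a := z)] at hSz
    set A := matchingPolyOn G (S.erase w) with hA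
    set B := matchingPolyOn G ((S.erase w).erase z) with hB
    set N := ((S.erase w).erase z).filter (G.Adj w) with hN
    have hnonneg : 0 ≤ ∑ y ∈ N, (matchingPolyOn G ((S.erase w).erase y) * B -
        A * matchingPolyOn G (((S.erase w).erase z).erase y)).eval x := by
      refine Finset.sum_nonneg fun y hy => ?_
      simp only [hN, Finset.mem_filter, Finset.mem_erase] at hy
      have := (ih _ (Finset.erase_ssubset hw) (w := y) (z := z)
        (Finset.mem_erase.2 hy.1.2) hzw hy.1.1).1
      rwa [Finset.erase_right_comm (a := y)] at this
    rw [← eval_finsetSum, Finset.sum_sub_distrib, ← Finset.sum_mul, ← Finset.mul_sum] at hnonneg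
    by_cases hadj : G.Adj w z
    · have hnbr : (S.erase w).filter (G.Adj w) = insert z N := by
        ext y
        by_cases hy : y = z
        · subst hy
          simp [hz, hadj, hwz.symm]
        · simp [hN, hy]
      rw [hnbr, Finset.sum_insert (by simp [hN])] at hS
      have hle : (B.eval x) ^ 2 ≤ (A * matchingPolyOn G (S.erase z) -
          matchingPolyOn G S * B).eval x := by
        rw [hS, hSz]
        simp only [eval_sub, eval_mul, eval_add, eval_X] at hnonneg ⊢
        nlinarith
      exact ⟨(sq_nonneg _).trans hle, fun _ => hle⟩
    · have hnbr : (S.erase w).filter (G.Adj w) = N := by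
        ext y
        by_cases hy : y = z
        · subst hy
          simp [hN, hadj]
        · simp [hN, hy]
      rw [hnbr] at hS
      refine ⟨?_, fun h => absurd h hadj⟩
      rw [hS, hSz]
      simp only [eval_sub, eval_mul, eval_X] at hnonneg ⊢
      nlinarith

lemma matchingPolyOn_ne_zero [Fintype V] (G : SimpleGraph V) (S : Finset V) :
    matchingPolyOn G S ≠ 0 := by
  classical
  induction S using Finset.induction_on with
  | empty => simp [matchingPolyOn_empty]
  | insert w S hw ih =>
    intro h0
    refine ih (Polynomial.funext fun x => ?_)
    have := sq_eval_le_eval_wronskian G (insert w S) w (by simp) x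
    rw [h0, Finset.erase_insert hw] at this
    simp only [derivative_zero, zero_mul, sub_zero, eval_zero] at this
    simpa using le_antisymm this (sq_nonneg _)

lemma X_sub_C_pow_dvd_of_sq_eval_le {P Q : ℝ[X]} {θ : ℝ} (b : ℕ)
    (hle : ∀ x, (Q.eval x) ^ 2 ≤ P.eval x) (hP : (X - C θ) ^ (2 * b + 1) ∣ P) :
    (X - C θ) ^ (b + 1) ∣ Q := by
  induction b generalizing P Q with
  | zero =>
    rw [zero_add, pow_one, dvd_iff_isRoot, IsRoot]
    obtain ⟨R, rfl⟩ := hP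
    have := hle θ
    simp only [eval_mul, eval_pow, eval_sub, eval_X, eval_C, sub_self] at this
    simpa using le_antisymm (by simpa using this) (sq_nonneg (Q.eval θ))
  | succ b ih =>
    have hroot : (X - C θ) ^ 1 ∣ Q := by
      rw [pow_one, dvd_iff_isRoot, IsRoot]
      obtain ⟨R, rfl⟩ := hP
      have := hle θ
      simp only [eval_mul, eval_pow, eval_sub, eval_X, eval_C, sub_self] at this
      simpa using le_antisymm (by simpa using this) (sq_nonneg (Q.eval θ))
    obtain ⟨Q', rfl⟩ := hroot
    obtain ⟨R, rfl⟩ := hP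
    rw [pow_one, pow_succ' _ (b + 1)]
    refine mul_dvd_mul_left _ (ih (P := (X - C θ) ^ (2 * b + 1) * R) ?_ (dvd_mul_right _ _))
    have hne : ∀ x ≠ θ, (Q'.eval x) ^ 2 ≤ ((X - C θ) ^ (2 * b + 1) * R).eval x := by
      intro x hx
      have hpos : 0 < (x - θ) ^ 2 := by
        have := sub_ne_zero.2 hx
        positivity
      have := hle x
      simp only [eval_mul, eval_pow, eval_sub, eval_X, eval_C] at this ⊢
      refine le_of_mul_le_mul_left ?_ hpos
      calc _ = ((x - θ) ^ 1 * Q'.eval x) ^ 2 := by ring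
        _ ≤ _ := this
        _ = _ := by ring
    intro x
    have hclosed : IsClosed {x | (Q'.eval x) ^ 2 ≤ ((X - C θ) ^ (2 * b + 1) * R).eval x} :=
      isClosed_le (Q'.continuous.pow 2) (Polynomial.continuous _)
    have hdense : Dense ({θ}ᶜ : Set ℝ) := dense_compl_singleton θ
    exact hclosed.closure_subset_iff.2 hne (hdense x)

/-- A nonnegative real polynomial has no simple roots. -/
lemma X_sub_C_sq_dvd_of_eval_nonneg {P : ℝ[X]} {θ : ℝ} (hP : ∀ x, 0 ≤ P.eval x)
    (hroot : P.eval θ = 0) : (X - C θ) ^ 2 ∣ P := by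
  have hd : (derivative P).eval θ = 0 := by
    have hmin : IsLocalMin (fun x => P.eval x) θ :=
      Filter.Eventually.of_forall fun x => by simpa [hroot] using hP x
    exact hmin.hasDerivAt_eq_zero (P.hasDerivAt θ)
  obtain ⟨R, rfl⟩ := dvd_iff_isRoot.2 hroot
  have hR : R.eval θ = 0 := by simpa [derivative_mul] using hd
  rw [pow_two]
  exact mul_dvd_mul_left _ (dvd_iff_isRoot.2 hR)

lemma rootMultiplicity_le_add_one_of_sq_le_wronskian {P Q : ℝ[X]} (hQ : Q ≠ 0) (θ : ℝ)
    (hle : ∀ x, (Q.eval x) ^ 2 ≤ (derivative P * Q - P * derivative Q).eval x) :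
    P.rootMultiplicity θ ≤ Q.rootMultiplicity θ + 1 := by
  by_contra! hlt
  have hmul : ∀ {R T : ℝ[X]} {m n k : ℕ}, (X - C θ) ^ m ∣ R → (X - C θ) ^ n ∣ T → k ≤ m + n →
      (X - C θ) ^ k ∣ R * T := fun hR hT hk =>
    (pow_dvd_pow _ hk).trans (pow_add (X - C θ) _ _ ▸ mul_dvd_mul hR hT)
  have hdvdQ : (X - C θ) ^ Q.rootMultiplicity θ ∣ Q := pow_rootMultiplicity_dvd _ _
  have hdvdP : (X - C θ) ^ P.rootMultiplicity θ ∣ P := pow_rootMultiplicity_dvd _ _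
  have hdvd : (X - C θ) ^ (Q.rootMultiplicity θ + 1) ∣ Q :=
    X_sub_C_pow_dvd_of_sq_eval_le _ hle (dvd_sub
      (hmul (pow_sub_one_dvd_derivative_of_pow_dvd hdvdP) hdvdQ (by omega))
      (hmul hdvdP (pow_sub_one_dvd_derivative_of_pow_dvd hdvdQ) (by omega)))
  have := (le_rootMultiplicity_iff hQ).2 hdvd
  omega

/-- Deleting a vertex lowers the multiplicity of a root by at most one. -/
lemma rootMultiplicity_le_erase_add_one [Fintype V] [DecidableEq V] (G : SimpleGraph V)
    {S : Finset V} {w : V} (hw : w ∈ S) (θ : ℝ) :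
    (matchingPolyOn G S).rootMultiplicity θ ≤
      (matchingPolyOn G (S.erase w)).rootMultiplicity θ + 1 :=
  rootMultiplicity_le_add_one_of_sq_le_wronskian (matchingPolyOn_ne_zero G _) θ
    (sq_eval_le_eval_wronskian G S w hw)

/-- Deleting a vertex raises the multiplicity of a root by at most one. -/
lemma rootMultiplicity_erase_le_add_one [Fintype V] [DecidableEq V] (G : SimpleGraph V)
    {S : Finset V} {w : V} (hw : w ∈ S) (θ : ℝ) :
    (matchingPolyOn G (S.erase w)).rootMultiplicity θ ≤
      (matchingPolyOn G S).rootMultiplicity θ + 1 := by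
  classical
  suffices (matchingPolyOn G (S.erase w)).rootMultiplicity θ - 1 ≤
      (matchingPolyOn G S).rootMultiplicity θ by omega
  rw [le_rootMultiplicity_iff (matchingPolyOn_ne_zero G _), matchingPolyOn_eq_sub hw]
  refine dvd_sub ?_ (Finset.dvd_sum fun y hy => ?_)
  · have : (X - C θ) ^ ((matchingPolyOn G (S.erase w)).rootMultiplicity θ - 1) ∣
        matchingPolyOn G (S.erase w) :=
      (pow_dvd_pow _ (Nat.sub_le _ _)).trans (pow_rootMultiplicity_dvd _ _)
    convert this.mul_left X
  · have hle := rootMultiplicity_le_erase_add_one G (Finset.mem_filter.1 hy).1 θ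
    exact (pow_dvd_pow _ (Nat.sub_le_of_le_add hle)).trans (pow_rootMultiplicity_dvd _ _)

lemma rootMultiplicity_matchingPolyOn_pos_iff [Fintype V] {G : SimpleGraph V} {S : Finset V}
    {θ : ℝ} :
    0 < (matchingPolyOn G S).rootMultiplicity θ ↔ (matchingPolyOn G S).eval θ = 0 :=
  rootMultiplicity_pos (matchingPolyOn_ne_zero G S)

/-- In a graph with a root of multiplicity at least two, deleting two adjacent vertices leaves
a root. -/
lemma eval_erase_erase_eq_zero_of_adj [Fintype V] [DecidableEq V] {G : SimpleGraph V}
    {S : Finset V} {w z : V} (hw : w ∈ S) (hz : z ∈ S) (hwz : G.Adj w z) {θ : ℝ}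
    (hS : 2 ≤ (matchingPolyOn G S).rootMultiplicity θ) :
    (matchingPolyOn G ((S.erase w).erase z)).eval θ = 0 := by
  have hle := (eval_erase_erase_sq_le G S hw hz hwz.ne θ).2 hwz
  have h0 := rootMultiplicity_matchingPolyOn_pos_iff.1 (by omega :
    0 < (matchingPolyOn G S).rootMultiplicity θ)
  have hw0 := rootMultiplicity_matchingPolyOn_pos_iff.1
    (by have := rootMultiplicity_le_erase_add_one G hw θ; omega :
      0 < (matchingPolyOn G (S.erase w)).rootMultiplicity θ)
  rw [eval_sub, eval_mul, eval_mul, h0, hw0, zero_mul, zero_mul, sub_zero] at hle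
  simpa using le_antisymm hle (sq_nonneg _)

/-- If `θ` is not a root but becomes a simple root on deleting `w` or `z`, then deleting both
gives a double root or none. -/
lemma rootMultiplicity_erase_erase_eq_two_iff [Fintype V] [DecidableEq V] {G : SimpleGraph V}
    {S : Finset V} {w z : V} (hw : w ∈ S) (hz : z ∈ S) (hwz : w ≠ z) {θ : ℝ}
    (hS : (matchingPolyOn G S).rootMultiplicity θ = 0)
    (hSw : (matchingPolyOn G (S.erase w)).rootMultiplicity θ = 1)
    (hSz : (matchingPolyOn G (S.erase z)).rootMultiplicity θ = 1) :
    (matchingPolyOn G ((S.erase w).erase z)).rootMultiplicity θ = 2 ↔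
      (matchingPolyOn G ((S.erase w).erase z)).eval θ = 0 := by
  refine ⟨fun h => rootMultiplicity_matchingPolyOn_pos_iff.1 (by omega), fun h0 => ?_⟩
  have hle := rootMultiplicity_erase_le_add_one G
    (Finset.mem_erase.2 ⟨hwz.symm, hz⟩ : z ∈ S.erase w) θ
  have hprod : (X - C θ) ^ 2 ∣ matchingPolyOn G (S.erase w) * matchingPolyOn G (S.erase z) := by
    rw [pow_two]
    exact mul_dvd_mul (dvd_iff_isRoot.2 (rootMultiplicity_matchingPolyOn_pos_iff.1 (by omega)))
      (dvd_iff_isRoot.2 (rootMultiplicity_matchingPolyOn_pos_iff.1 (by omega)))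
  have hdiff := X_sub_C_sq_dvd_of_eval_nonneg
    (fun x => (eval_erase_erase_sq_le G S hw hz hwz x).1) (θ := θ) (by
      rw [eval_sub, eval_mul, eval_mul, h0, rootMultiplicity_matchingPolyOn_pos_iff.1
        (by omega : 0 < (matchingPolyOn G (S.erase w)).rootMultiplicity θ)]
      ring)
  have hmul : (X - C θ) ^ 2 ∣ matchingPolyOn G S * matchingPolyOn G ((S.erase w).erase z) :=
    (dvd_sub_right hprod).1 hdiff
  have hge := (le_rootMultiplicity_iff (mul_ne_zero (matchingPolyOn_ne_zero G _)
    (matchingPolyOn_ne_zero G _))).2 hmul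
  rw [rootMultiplicity_mul (mul_ne_zero (matchingPolyOn_ne_zero G _)
    (matchingPolyOn_ne_zero G _)), hS] at hge
  omega

lemma mult_eq_rootMultiplicity [Fintype V] (θ : ℝ) (G : SimpleGraph V) :
    mult θ G = (matchingPolyOn G Finset.univ).rootMultiplicity θ := by
  rw [mult, matchingPoly_eq_matchingPolyOn]

lemma mult_deleteVert_eq_rootMultiplicity [Fintype V] [DecidableEq V] (θ : ℝ)
    (G : SimpleGraph V) (x : V) :
    mult θ (deleteVert G x) = (matchingPolyOn G (Finset.univ.erase x)).rootMultiplicity θ := by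
  rw [mult, deleteVert, matchingPoly_induce G (S := Finset.univ.erase x) (by simp)]

lemma isExtreme_pair_iff [Fintype V] [DecidableEq V] {θ : ℝ} {G : SimpleGraph V}
    (hG : IsSuperPositive θ G) {w z : V} (hwz : w ≠ z) :
    IsExtreme θ G {w, z} ↔
      (matchingPolyOn G ((Finset.univ.erase w).erase z)).eval θ = 0 := by
  obtain ⟨h0, h1⟩ := hG
  rw [IsExtreme, h0, Set.ncard_pair hwz, zero_add, mult, deleteSet,
    matchingPoly_induce G (S := (Finset.univ.erase w).erase z) (by simp; tauto)]
  rw [mult_eq_rootMultiplicity] at h0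
  simp only [mult_deleteVert_eq_rootMultiplicity] at h1
  exact rootMultiplicity_erase_erase_eq_two_iff (Finset.mem_univ w) (Finset.mem_univ z) hwz h0
    (h1 w) (h1 z)

/-- Deleting a `θ`-extreme edge preserves `θ`-super positivity. -/
lemma IsSuperPositive.deleteEdges [Fintype V] {θ : ℝ} {G : SimpleGraph V}
    (hG : IsSuperPositive θ G) {u v : V} (huv : G.Adj u v) (hext : IsExtreme θ G {u, v}) :
    IsSuperPositive θ (G.deleteEdges {s(u, v)}) := by
  classical
  have huv0 := (isExtreme_pair_iff hG huv.ne).1 hext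
  have hmult : (matchingPolyOn G ((Finset.univ.erase u).erase v)).rootMultiplicity θ = 2 := by
    rw [← matchingPoly_induce G (T := ({u, v} : Set V)ᶜ) (by simp; tauto)]
    have := hext
    rwa [IsExtreme, hG.1, Set.ncard_pair huv.ne, zero_add] at this
  obtain ⟨h0, h1⟩ := hG
  rw [mult_eq_rootMultiplicity] at h0
  simp only [mult_deleteVert_eq_rootMultiplicity] at h1
  have h0' : (matchingPolyOn (G.deleteEdges {s(u, v)}) Finset.univ).rootMultiplicity θ = 0 := by
    by_contra hne
    have := rootMultiplicity_matchingPolyOn_pos_iff.1 (Nat.pos_of_ne_zero hne)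
    rw [matchingPolyOn_deleteEdges (Finset.mem_univ u) (Finset.mem_univ v) huv, eval_add, huv0,
      add_zero, ← rootMultiplicity_matchingPolyOn_pos_iff] at this
    omega
  refine ⟨by rw [mult_eq_rootMultiplicity, h0'], fun x => ?_⟩
  rw [mult_deleteVert_eq_rootMultiplicity]
  by_cases hx : x = u ∨ x = v
  · rw [matchingPolyOn_deleteEdges_of_notMem (by rcases hx with rfl | rfl <;> simp), h1]
  · push Not at hx
    have hle := rootMultiplicity_erase_le_add_one (G.deleteEdges {s(u, v)}) (Finset.mem_univ x) θ
    have hx0 : (matchingPolyOn G (((Finset.univ.erase u).erase v).erase x)).eval θ = 0 := by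
      have := rootMultiplicity_le_erase_add_one G
        (by simp [hx] : x ∈ (Finset.univ.erase u).erase v) θ
      exact rootMultiplicity_matchingPolyOn_pos_iff.1 (by omega)
    have hx1 := rootMultiplicity_matchingPolyOn_pos_iff.1 (by rw [h1]; exact one_pos :
      0 < (matchingPolyOn G (Finset.univ.erase x)).rootMultiplicity θ)
    have hpos : 0 < (matchingPolyOn (G.deleteEdges {s(u, v)})
        (Finset.univ.erase x)).rootMultiplicity θ := by
      rw [rootMultiplicity_matchingPolyOn_pos_iff, matchingPolyOn_deleteEdges
        (by simp [hx.1.symm]) (by simp [hx.2.symm]) huv, eval_add, hx1, zero_add,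
        Finset.erase_right_comm (a := x), Finset.erase_right_comm (a := x), hx0]
    omega

/-- After deleting a θ-extreme edge, an edge of G' is θ-extreme in G' iff it is in G. -/
theorem stmt_16 {V : Type*} [Fintype V] (θ : ℝ) (G : SimpleGraph V)
    (h : IsSuperPositive θ G) (u v : V) (huv : G.Adj u v)
    (hext : IsExtreme θ G {u, v}) (w z : V)
    (hwz : (G.deleteEdges {s(u, v)}).Adj w z) :
    IsExtreme θ (G.deleteEdges {s(u, v)}) {w, z} ↔ IsExtreme θ G {w, z} := by
  classical
  have hwz' : G.Adj w z := (SimpleGraph.deleteEdges_le _) hwz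
  rw [isExtreme_pair_iff (h.deleteEdges huv hext) hwz.ne, isExtreme_pair_iff h hwz.ne]
  by_cases hmeet : u ∉ (Finset.univ.erase w).erase z ∨ v ∉ (Finset.univ.erase w).erase z
  · rw [matchingPolyOn_deleteEdges_of_notMem hmeet]
  · push Not at hmeet
    have hmult : 2 ≤ (matchingPolyOn G ((Finset.univ.erase u).erase v)).rootMultiplicity θ := by
      rw [← matchingPoly_induce G (T := ({u, v} : Set V)ᶜ) (by simp; tauto)]
      rw [IsExtreme, h.1, Set.ncard_pair huv.ne, zero_add] at hext
      exact hext.ge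
    have hmem := hmeet
    simp only [Finset.mem_erase, Finset.mem_univ, and_true, ne_eq] at hmem
    have hzero := eval_erase_erase_eq_zero_of_adj (S := (Finset.univ.erase u).erase v)
      (by simp [Ne.symm hmem.1.2, Ne.symm hmem.2.2]) (by simp [Ne.symm hmem.1.1, Ne.symm hmem.2.1])
      hwz' hmult
    have hcomm : (((Finset.univ.erase w).erase z).erase u).erase v =
        (((Finset.univ.erase u).erase v).erase w).erase z := by
      ext
      simp
      tauto
    rw [matchingPolyOn_deleteEdges hmeet.1 hmeet.2 huv, hcomm, eval_add, hzero, add_zero]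

end MatchPoly
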